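/- Let N ≥ 1, let k₁,…,k_N be nonzero real constants, let m ≥ 1 be an integer, and let u, v : ℝ^N → ℝ be C^∞ functions. Then □(◊^m(u,v)) = ◊^m(□u, v) + ◊^m(u, □v) + 2·◊^{m+1}(u,v). -/

import Mathlib

variable {N : ℕ}

/-- Partial derivative in the `i`-th coordinate direction. -/
noncomputable def pd (i : Fin N) (f : (Fin N → ℝ) → ℝ) : (Fin N → ℝ) → ℝ :=
  fun x => fderiv ℝ f x (Pi.single i 1)

/-- Iterated partial derivative along a list of coordinate directions. -/
noncomputable def mpd : List (Fin N) → ((Fin N → ℝ) → ℝ) → ((Fin N → ℝ) → ℝ)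
  | [], f => f
  | i :: l, f => pd i (mpd l f)

/-- The operator `□w = Σ_{i=1}^N (1/k_i) ∂²w/∂x_i²`. -/
noncomputable def box (k : Fin N → ℝ) (f : (Fin N → ℝ) → ℝ) : (Fin N → ℝ) → ℝ :=
  fun x => ∑ i : Fin N, (1 / k i) * pd i (pd i f) x

/-- The bilinear operator
`◊^m(u,v) = Σ_{i₁,…,i_m} (1/(k_{i₁}⋯k_{i_m})) (∂^m u/∂x_{i₁}⋯∂x_{i_m})·(∂^m v/∂x_{i₁}⋯∂x_{i_m})`. -/
noncomputable def diam (k : Fin N → ℝ) (m : ℕ) (u v : (Fin N → ℝ) → ℝ) :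
    (Fin N → ℝ) → ℝ :=
  fun x => ∑ ι : Fin m → Fin N,
    (∏ j : Fin m, 1 / k (ι j)) * mpd (List.ofFn ι) u x * mpd (List.ofFn ι) v x

section PartialDerivatives

variable {f g : (Fin N → ℝ) → ℝ}

lemma ContDiff.pd (hf : ContDiff ℝ (⊤ : ℕ∞) f) (i : Fin N) :
    ContDiff ℝ (⊤ : ℕ∞) (_root_.pd i f) :=
  (hf.fderiv_right (by simp)).clm_apply contDiff_const

lemma ContDiff.mpd (hf : ContDiff ℝ (⊤ : ℕ∞) f) (l : List (Fin N)) :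
    ContDiff ℝ (⊤ : ℕ∞) (_root_.mpd l f) := by
  induction l with
  | nil => exact hf
  | cons i l ih => exact ih.pd i

lemma pd_add (i : Fin N) (hf : Differentiable ℝ f) (hg : Differentiable ℝ g) :
    pd i (fun x => f x + g x) = fun x => pd i f x + pd i g x := by
  funext x
  simp [pd, fderiv_fun_add (hf x) (hg x)]

lemma pd_mul (i : Fin N) (hf : Differentiable ℝ f) (hg : Differentiable ℝ g) :
    pd i (fun x => f x * g x) = fun x => f x * pd i g x + pd i f x * g x := by
  funext x
  simp [pd, fderiv_fun_mul (hf x) (hg x), mul_comm]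

lemma pd_const_mul (i : Fin N) (c : ℝ) (hf : Differentiable ℝ f) :
    pd i (fun x => c * f x) = fun x => c * pd i f x := by
  funext x
  simp [pd, fderiv_const_mul (hf x)]

lemma pd_sum {ι : Type*} (s : Finset ι) (i : Fin N) {F : ι → (Fin N → ℝ) → ℝ}
    (hF : ∀ j ∈ s, Differentiable ℝ (F j)) :
    pd i (fun x => ∑ j ∈ s, F j x) = fun x => ∑ j ∈ s, pd i (F j) x := by
  funext x
  simp [pd, fderiv_fun_sum fun j hj => hF j hj x]

lemma pd_comm (hf : ContDiff ℝ (⊤ : ℕ∞) f) (i j : Fin N) :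
    pd i (pd j f) = pd j (pd i f) := by
  have hd : Differentiable ℝ (fderiv ℝ f) :=
    (hf.fderiv_right (m := (⊤ : ℕ∞)) (by simp)).differentiable (by simp)
  have key (a b : Fin N) (x : Fin N → ℝ) :
      pd a (pd b f) x = fderiv ℝ (fderiv ℝ f) x (Pi.single a 1) (Pi.single b 1) := by
    change fderiv ℝ (fun y => fderiv ℝ f y (Pi.single b 1)) x (Pi.single a 1) = _
    rw [fderiv_clm_apply (hd x) (differentiableAt_const _)]
    simp
  funext x
  rw [key, key]
  have hs : IsSymmSndFDerivAt ℝ f x := by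
    refine (contDiff_infty.1 hf 2).contDiffAt.isSymmSndFDerivAt ?_
    simp
  exact hs _ _

lemma ContDiff.differentiable_of_smooth (hf : ContDiff ℝ (⊤ : ℕ∞) f) : Differentiable ℝ f :=
  hf.differentiable (by simp)

lemma pd_box (k : Fin N → ℝ) (hf : ContDiff ℝ (⊤ : ℕ∞) f) (i : Fin N) :
    pd i (box k f) = box k (pd i f) := by
  have hd (j : Fin N) := ((hf.pd j).pd j).differentiable_of_smooth
  unfold box
  rw [pd_sum _ _ fun j _ => (hd j).const_mul _]
  funext x
  refine Finset.sum_congr rfl fun j _ => ?_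
  rw [pd_const_mul _ _ (hd j), pd_comm (hf.pd j), pd_comm hf i j]

lemma mpd_box (k : Fin N → ℝ) (hf : ContDiff ℝ (⊤ : ℕ∞) f) (l : List (Fin N)) :
    mpd l (box k f) = box k (mpd l f) := by
  induction l with
  | nil => rfl
  | cons i l ih => rw [mpd, ih, pd_box k (hf.mpd l), mpd]

lemma box_const_mul (k : Fin N → ℝ) (c : ℝ) (hf : ContDiff ℝ (⊤ : ℕ∞) f) :
    box k (fun x => c * f x) = fun x => c * box k f x := by
  funext x
  simp only [box, Finset.mul_sum]
  refine Finset.sum_congr rfl fun i _ => ?_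
  rw [pd_const_mul i c hf.differentiable_of_smooth,
    pd_const_mul i c (hf.pd i).differentiable_of_smooth]
  ring

lemma box_sum {ι : Type*} (s : Finset ι) (k : Fin N → ℝ) {F : ι → (Fin N → ℝ) → ℝ}
    (hF : ∀ j ∈ s, ContDiff ℝ (⊤ : ℕ∞) (F j)) :
    box k (fun x => ∑ j ∈ s, F j x) = fun x => ∑ j ∈ s, box k (F j) x := by
  funext x
  simp only [box]
  rw [Finset.sum_comm]
  refine Finset.sum_congr rfl fun i _ => ?_
  rw [pd_sum s i fun j hj => (hF j hj).differentiable_of_smooth,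
    pd_sum s i fun j hj => ((hF j hj).pd i).differentiable_of_smooth, Finset.mul_sum]

/-- The product rule for `□`. -/
lemma box_mul (k : Fin N → ℝ) (hf : ContDiff ℝ (⊤ : ℕ∞) f) (hg : ContDiff ℝ (⊤ : ℕ∞) g) :
    box k (fun x => f x * g x) = fun x => box k f x * g x + f x * box k g x +
      2 * ∑ i, (1 / k i) * (pd i f x * pd i g x) := by
  funext x
  simp only [box, Finset.mul_sum, Finset.sum_mul, ← Finset.sum_add_distrib]
  refine Finset.sum_congr rfl fun i _ => ?_
  have hf₀ := hf.differentiable_of_smooth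
  have hg₀ := hg.differentiable_of_smooth
  have hf₁ := (hf.pd i).differentiable_of_smooth
  have hg₁ := (hg.pd i).differentiable_of_smooth
  rw [pd_mul i hf₀ hg₀, pd_add i (hf₀.fun_mul hg₁) (hf₁.fun_mul hg₀), pd_mul i hf₀ hg₁,
    pd_mul i hf₁ hg₀]
  ring

end PartialDerivatives

lemma diam_succ (k : Fin N → ℝ) (m : ℕ) (u v : (Fin N → ℝ) → ℝ) (x : Fin N → ℝ) :
    diam k (m + 1) u v x = ∑ ι : Fin m → Fin N, (∏ j, 1 / k (ι j)) *
      ∑ i, (1 / k i) * (pd i (mpd (List.ofFn ι) u) x * pd i (mpd (List.ofFn ι) v) x) := by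
  simp only [diam, Finset.mul_sum]
  rw [← (Fin.consEquiv fun _ => Fin N).sum_comp, Fintype.sum_prod_type, Finset.sum_comm]
  refine Finset.sum_congr rfl fun ι _ => Finset.sum_congr rfl fun i _ => ?_
  simp only [Fin.consEquiv_apply, List.ofFn_succ, Fin.prod_univ_succ, Fin.cons_zero,
    Fin.cons_succ, mpd]
  ring

/-- Key inductive step of Proposition 2.2:
`□(◊^m(u,v)) = ◊^m(□u, v) + ◊^m(u, □v) + 2◊^{m+1}(u,v)`. -/
theorem box_diam (hN : 1 ≤ N) (k : Fin N → ℝ) (hk : ∀ i, k i ≠ 0)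
    (m : ℕ) (hm : 1 ≤ m)
    (u v : (Fin N → ℝ) → ℝ) (hu : ContDiff ℝ (⊤ : ℕ∞) u) (hv : ContDiff ℝ (⊤ : ℕ∞) v) :
    box k (diam k m u v) =
      fun x => diam k m (box k u) v x + diam k m u (box k v) x +
        2 * diam k (m + 1) u v x := by
  have hu' (ι : Fin m → Fin N) := hu.mpd (List.ofFn ι)
  have hv' (ι : Fin m → Fin N) := hv.mpd (List.ofFn ι)
  have hd : diam k m u v = fun x => ∑ ι : Fin m → Fin N,
      (∏ j, 1 / k (ι j)) * (mpd (List.ofFn ι) u x * mpd (List.ofFn ι) v x) := by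
    simp only [← mul_assoc]
    rfl
  rw [hd, box_sum _ _ fun ι _ => contDiff_const.mul ((hu' ι).mul (hv' ι))]
  funext x
  rw [diam_succ]
  simp only [diam]
  rw [Finset.mul_sum, ← Finset.sum_add_distrib, ← Finset.sum_add_distrib]
  refine Finset.sum_congr rfl fun ι _ => ?_
  rw [box_const_mul _ _ ((hu' ι).mul (hv' ι)), box_mul k (hu' ι) (hv' ι), mpd_box k hu,
    mpd_box k hv]
  ring
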